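/- arXiv:2310.00306 — 3 statements merged into one kernel-verified Lean document; each statement's English description precedes it below -/
import Mathlib

section
/- If g, h : S → X are |RL| ν-integrable on S and α, β ∈ ℝ, then αg + βh is |RL| ν-integrable on S and (|RL|)∫_S (αg + βh) dν = α·(|RL|)∫_S g dν + β·(|RL|)∫_S h dν. -/
open Filter Topology

/-- A countable partition of `E` (indexed by `ℕ`): pairwise disjoint measurable sets whose
union is `E`.  Sets are allowed to be empty so that finite partitions are also included;
since `ν ∅ = 0`, empty pieces contribute nothing to the Riemann–Lebesgue sums. -/
def IsCtblePartition {S : Type*} [MeasurableSpace S] (E : Set S) (A : ℕ → Set S) : Prop :=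
  (∀ n, MeasurableSet (A n)) ∧ Pairwise (Function.onFun Disjoint A) ∧ (⋃ n, A n) = E

/-- `P'` is finer than `P`: every set of `P'` is included in some set of `P`. -/
def FinerThan {S : Type*} (P P' : ℕ → Set S) : Prop := ∀ n, ∃ m, P' n ⊆ P m

/-- `t` is a choice of tags for the partition `P` : `t n ∈ P n` whenever `P n ≠ ∅`. -/
def AreTags {S : Type*} (P : ℕ → Set S) (t : ℕ → S) : Prop := ∀ n, (P n).Nonempty → t n ∈ P n

/-- `h : S → X` is absolutely Riemann–Lebesgue `ν`-integrable on `E` with integral `a`: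
for every `ε > 0` there is a countable partition `P₀` of `E` such that for every finer
countable partition `P = {A_n}` of `E`, `h` is bounded on every `A_n` with `ν (A_n) > 0`,
and for every choice of tags `s_n ∈ A_n` the series `Σ_n h (s_n) • ν (A_n)` converges
absolutely with `‖Σ_n h (s_n) • ν (A_n) - a‖ < ε`. -/
def AbsRL {S : Type*} [MeasurableSpace S] {X : Type*} [NormedAddCommGroup X] [NormedSpace ℝ X]
    (ν : Set S → ℝ) (h : S → X) (E : Set S) (a : X) : Prop :=
  ∀ ε > 0, ∃ P₀ : ℕ → Set S, IsCtblePartition E P₀ ∧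
    ∀ P : ℕ → Set S, IsCtblePartition E P → FinerThan P₀ P →
      (∀ n, 0 < ν (P n) → ∃ M, ∀ s ∈ P n, ‖h s‖ ≤ M) ∧
      ∀ t : ℕ → S, AreTags P t →
        Summable (fun n => ‖ν (P n) • h (t n)‖) ∧
        ‖(∑' n, ν (P n) • h (t n)) - a‖ < ε

/-- `h : S → X` is (unconditionally) Riemann–Lebesgue `ν`-integrable on `E` with integral `a`:
as `AbsRL`, but the series is only required to converge unconditionally. -/
def RL {S : Type*} [MeasurableSpace S] {X : Type*} [NormedAddCommGroup X] [NormedSpace ℝ X]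
    (ν : Set S → ℝ) (h : S → X) (E : Set S) (a : X) : Prop :=
  ∀ ε > 0, ∃ P₀ : ℕ → Set S, IsCtblePartition E P₀ ∧
    ∀ P : ℕ → Set S, IsCtblePartition E P → FinerThan P₀ P →
      (∀ n, 0 < ν (P n) → ∃ M, ∀ s ∈ P n, ‖h s‖ ≤ M) ∧
      ∀ t : ℕ → S, AreTags P t →
        Summable (fun n => ν (P n) • h (t n)) ∧
        ‖(∑' n, ν (P n) • h (t n)) - a‖ < ε

/-- `h` is Birkhoff simple `ν`-integrable on `E` with integral `b`. -/
def BirkhoffSimple {S : Type*} [MeasurableSpace S] {X : Type*} [NormedAddCommGroup X]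
    [NormedSpace ℝ X] (ν : Set S → ℝ) (h : S → X) (E : Set S) (b : X) : Prop :=
  ∀ ε > 0, ∃ P₀ : ℕ → Set S, IsCtblePartition E P₀ ∧
    ∀ P : ℕ → Set S, IsCtblePartition E P → FinerThan P₀ P →
      ∀ t : ℕ → S, AreTags P t →
        Filter.limsup (fun n => ‖(∑ k ∈ Finset.range (n + 1), ν (P k) • h (t k)) - b‖)
          Filter.atTop < ε

/-- The set of all finite sums `Σ_i ν (A_i)` over finite pairwise disjoint families of
measurable sets contained in `E`. -/
def variationSet {S : Type*} [MeasurableSpace S] (ν : Set S → ℝ) (E : Set S) : Set ℝ :=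
  { x | ∃ (k : ℕ) (A : Fin k → Set S), (∀ i, MeasurableSet (A i)) ∧ (∀ i, A i ⊆ E) ∧
        Pairwise (Function.onFun Disjoint A) ∧ x = ∑ i, ν (A i) }

/-- The variation `ν̄ (E)` of a set function `ν`. -/
noncomputable def variation {S : Type*} [MeasurableSpace S] (ν : Set S → ℝ) (E : Set S) : ℝ :=
  sSup (variationSet ν E)

/-- `ν` is of finite variation (on `S`). -/
def FiniteVariation {S : Type*} [MeasurableSpace S] (ν : Set S → ℝ) : Prop :=
  BddAbove (variationSet ν Set.univ)

/-- The semivariation `ν̃ (A) = inf { ν̄ (B) : A ⊆ B, B measurable }`. -/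
noncomputable def semivariation {S : Type*} [MeasurableSpace S] (ν : Set S → ℝ)
    (A : Set S) : ℝ :=
  sInf { x | ∃ B : Set S, MeasurableSet B ∧ A ⊆ B ∧ x = variation ν B }

/-- A finite partition of `E`, indexed by `Fin k` (pieces may be empty). -/
def IsFinPartition {S : Type*} [MeasurableSpace S] (E : Set S) {k : ℕ}
    (A : Fin k → Set S) : Prop :=
  (∀ i, MeasurableSet (A i)) ∧ Pairwise (Function.onFun Disjoint A) ∧ (⋃ i, A i) = E

/-- `h` is Gould `ν`-integrable on `E` with integral `a`. -/
def Gould {S : Type*} [MeasurableSpace S] (ν : Set S → ℝ) (h : S → ℝ) (E : Set S)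
    (a : ℝ) : Prop :=
  ∀ ε > 0, ∃ (k : ℕ) (P₀ : Fin k → Set S), IsFinPartition E P₀ ∧
    ∀ (l : ℕ) (P : Fin l → Set S), IsFinPartition E P → (∀ j, ∃ i, P j ⊆ P₀ i) →
      ∀ t : Fin l → S, (∀ j, (P j).Nonempty → t j ∈ P j) →
        |(∑ j, ν (P j) * h (t j)) - a| < ε

/-- Condition (E) for a set function `μ` (defined at least on the measurable sets). -/
def ConditionE {S : Type*} [MeasurableSpace S] (μ : Set S → ℝ) : Prop :=
  ∀ B : ℕ → ℕ → Set S, (∀ m n, MeasurableSet (B m n)) →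
    (∀ m, Antitone fun n => B m n) →
    μ (⋃ m, ⋂ n, B m n) = 0 →
    ∃ np mp : ℕ → ℕ, StrictMono np ∧ StrictMono mp ∧
      Filter.Tendsto (fun k => μ (⋃ p, ⋃ (_ : k ≤ p), B (mp p) (np p)))
        Filter.atTop (nhds 0)

/-- The common refinement of two countable partitions, enumerated through `Nat.unpair`. -/
def commonRefinement {S : Type*} (P Q : ℕ → Set S) (n : ℕ) : Set S :=
  P n.unpair.1 ∩ Q n.unpair.2

theorem IsCtblePartition.commonRefinement {S : Type*} [MeasurableSpace S] {E : Set S}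
    {P Q : ℕ → Set S} (hP : IsCtblePartition E P) (hQ : IsCtblePartition E Q) :
    IsCtblePartition E (commonRefinement P Q) := by
  obtain ⟨hPm, hPd, hPu⟩ := hP
  obtain ⟨hQm, hQd, hQu⟩ := hQ
  refine ⟨fun n => (hPm _).inter (hQm _), fun m n hmn => ?_, ?_⟩
  · by_cases h₁ : m.unpair.1 = n.unpair.1
    · have h₂ : m.unpair.2 ≠ n.unpair.2 := fun h₂ =>
        hmn (by rw [← Nat.pair_unpair m, ← Nat.pair_unpair n, h₁, h₂])
      exact (hQd h₂).mono Set.inter_subset_right Set.inter_subset_right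
    · exact (hPd h₁).mono Set.inter_subset_left Set.inter_subset_left
  · ext x
    constructor
    · intro hx
      obtain ⟨n, hn⟩ := Set.mem_iUnion.1 hx
      exact hPu ▸ Set.mem_iUnion.2 ⟨_, hn.1⟩
    · intro hx
      obtain ⟨i, hi⟩ := Set.mem_iUnion.1 (hPu.symm ▸ hx)
      obtain ⟨j, hj⟩ := Set.mem_iUnion.1 (hQu.symm ▸ hx)
      refine Set.mem_iUnion.2 ⟨Nat.pair i j, ?_⟩
      simpa [_root_.commonRefinement] using And.intro hi hj

theorem FinerThan.left_of_commonRefinement {S : Type*} {P Q R : ℕ → Set S}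
    (h : FinerThan (commonRefinement P Q) R) : FinerThan P R := fun n =>
  let ⟨_, hm⟩ := h n
  ⟨_, hm.trans Set.inter_subset_left⟩

theorem FinerThan.right_of_commonRefinement {S : Type*} {P Q R : ℕ → Set S}
    (h : FinerThan (commonRefinement P Q) R) : FinerThan Q R := fun n =>
  let ⟨_, hm⟩ := h n
  ⟨_, hm.trans Set.inter_subset_right⟩

/-- linearity of the `|RL|` integral in the integrand. -/
theorem absRL_linear
    {S : Type*} [Nonempty S] [MeasurableSpace S]
    {X : Type*} [NormedAddCommGroup X] [NormedSpace ℝ X] [CompleteSpace X]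
    (ν : Set S → ℝ) (hν0 : ν ∅ = 0) (hνnn : ∀ A : Set S, MeasurableSet A → 0 ≤ ν A)
    (g h : S → X) (α β : ℝ) (ag ah : X)
    (hg : AbsRL ν g Set.univ ag) (hh : AbsRL ν h Set.univ ah) :
    AbsRL ν (fun s => α • g s + β • h s) Set.univ (α • ag + β • ah) := by
  intro ε hε
  have hc : 0 < |α| + |β| + 1 := by positivity
  obtain ⟨P, hP, hgP⟩ := hg (ε / (|α| + |β| + 1)) (by positivity)
  obtain ⟨Q, hQ, hhQ⟩ := hh (ε / (|α| + |β| + 1)) (by positivity)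
  refine ⟨commonRefinement P Q, hP.commonRefinement hQ, fun R hR hfine => ?_⟩
  obtain ⟨hgb, hgt⟩ := hgP R hR hfine.left_of_commonRefinement
  obtain ⟨hhb, hht⟩ := hhQ R hR hfine.right_of_commonRefinement
  refine ⟨fun n hn => ?_, fun t ht => ?_⟩
  · obtain ⟨M, hM⟩ := hgb n hn
    obtain ⟨N, hN⟩ := hhb n hn
    refine ⟨|α| * M + |β| * N, fun s hs => (norm_add_le _ _).trans ?_⟩
    rw [norm_smul, norm_smul, Real.norm_eq_abs, Real.norm_eq_abs]
    gcongr
    exacts [hM s hs, hN s hs]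
  · obtain ⟨hgs, hgε⟩ := hgt t ht
    obtain ⟨hhs, hhε⟩ := hht t ht
    have hterm : ∀ n, ν (R n) • (α • g (t n) + β • h (t n)) =
        α • ν (R n) • g (t n) + β • ν (R n) • h (t n) := fun n => by
      rw [smul_add, smul_comm α, smul_comm β]
    simp only [hterm]
    constructor
    · refine Summable.of_nonneg_of_le (fun _ => norm_nonneg _) (fun n => ?_)
        ((hgs.mul_left |α|).add (hhs.mul_left |β|))
      refine (norm_add_le _ _).trans_eq ?_
      rw [norm_smul α, norm_smul β, Real.norm_eq_abs, Real.norm_eq_abs]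
    · rw [(hgs.of_norm.const_smul α).tsum_add (hhs.of_norm.const_smul β),
        hgs.of_norm.tsum_const_smul, hhs.of_norm.tsum_const_smul, add_sub_add_comm,
        ← smul_sub, ← smul_sub]
      refine (norm_add_le _ _).trans_lt ?_
      rw [norm_smul, norm_smul, Real.norm_eq_abs, Real.norm_eq_abs]
      calc _ ≤ |α| * (ε / (|α| + |β| + 1)) + |β| * (ε / (|α| + |β| + 1)) := by gcongr
        _ < (|α| + |β| + 1) * (ε / (|α| + |β| + 1)) := by
          have : 0 < ε / (|α| + |β| + 1) := by positivity
          linarith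
        _ = ε := by field_simp
end

section
/- Let ν be of finite variation and g, h : S → X with sup_{s∈S} ‖g(s) − h(s)‖ < ∞. If g is |RL| ν-integrable on S and ν̃({s ∈ S : g(s) ≠ h(s)}) = 0, then h is |RL| ν-integrable on S and (|RL|)∫_S g dν = (|RL|)∫_S h dν. -/
open Filter Topology

/-- The pieces of a sequence of sets, each cut in two by `B`. -/
def splitBy {S : Type*} (P : ℕ → Set S) (B : Set S) (n : ℕ) : Set S :=
  P (n / 2) ∩ (if Even n then B else Bᶜ)

theorem IsCtblePartition.splitBy {S : Type*} [MeasurableSpace S] {E : Set S} {P : ℕ → Set S}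
    (hP : IsCtblePartition E P) {B : Set S} (hB : MeasurableSet B) :
    IsCtblePartition E (splitBy P B) := by
  obtain ⟨hmeas, hdisj, hunion⟩ := hP
  refine ⟨fun n => ?_, fun m n hmn => ?_, ?_⟩
  · unfold _root_.splitBy
    split_ifs
    · exact (hmeas _).inter hB
    · exact (hmeas _).inter hB.compl
  · rw [Function.onFun, Set.disjoint_left]
    rintro x ⟨hxm, hxBm⟩ ⟨hxn, hxBn⟩
    have hdiv : m / 2 = n / 2 := by
      by_contra hne
      exact Set.disjoint_left.mp (hdisj hne) hxm hxn
    split_ifs at hxBm hxBn with hm hn hn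
    · rw [Nat.even_iff] at hm hn
      omega
    · exact hxBn hxBm
    · exact hxBm hxBn
    · rw [Nat.even_iff] at hm hn
      omega
  · rw [← hunion]
    refine Set.Subset.antisymm
      (Set.iUnion_subset fun n x hx => Set.mem_iUnion.mpr ⟨n / 2, hx.1⟩)
      (Set.iUnion_subset fun n x hx => Set.mem_iUnion.mpr ?_)
    by_cases hxB : x ∈ B
    · exact ⟨2 * n, by simpa [_root_.splitBy] using ⟨hx, hxB⟩⟩
    · refine ⟨2 * n + 1, ?_, ?_⟩
      · rwa [show (2 * n + 1) / 2 = n by omega]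
      · simpa [Nat.even_add_one] using hxB

theorem finerThan_splitBy {S : Type*} (P : ℕ → Set S) (B : Set S) :
    FinerThan P (splitBy P B) :=
  fun n => ⟨n / 2, Set.inter_subset_left⟩

theorem FinerThan.trans {S : Type*} {P Q R : ℕ → Set S} (hPQ : FinerThan P Q)
    (hQR : FinerThan Q R) : FinerThan P R := by
  intro n
  obtain ⟨m, hm⟩ := hQR n
  obtain ⟨l, hl⟩ := hPQ m
  exact ⟨l, hm.trans hl⟩

theorem FinerThan.subset_or_disjoint_of_splitBy {S : Type*} {P Q : ℕ → Set S} {B : Set S}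
    (h : FinerThan (splitBy P B) Q) (n : ℕ) : Q n ⊆ B ∨ Disjoint (Q n) B := by
  obtain ⟨m, hm⟩ := h n
  have hsub : Q n ⊆ if Even m then B else Bᶜ := hm.trans Set.inter_subset_right
  split_ifs at hsub
  · exact Or.inl hsub
  · exact Or.inr (Set.subset_compl_iff_disjoint_right.mp hsub)

theorem FiniteVariation.bddAbove_variationSet {S : Type*} [MeasurableSpace S] {ν : Set S → ℝ}
    (hν : FiniteVariation ν) (E : Set S) : BddAbove (variationSet ν E) := by
  refine hν.mono ?_
  rintro x ⟨k, A, hA, -, hdisj, rfl⟩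
  exact ⟨k, A, hA, fun i => Set.subset_univ _, hdisj, rfl⟩

open Classical in
theorem sum_range_le_variation {S : Type*} [MeasurableSpace S] {ν : Set S → ℝ} (hν0 : ν ∅ = 0)
    (hfv : FiniteVariation ν) {E : Set S} {P : ℕ → Set S} (hP : IsCtblePartition E P)
    (B : Set S) (k : ℕ) :
    ∑ n ∈ Finset.range k, (if P n ⊆ B then ν (P n) else 0) ≤ variation ν B := by
  refine le_csSup (hfv.bddAbove_variationSet B)
    ⟨k, fun i => if P i ⊆ B then P i else ∅, fun i => ?_, fun i => ?_, fun i j hij => ?_, ?_⟩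
  · dsimp only
    split_ifs
    · exact hP.1 i
    · exact MeasurableSet.empty
  · dsimp only
    split_ifs with hi
    · exact hi
    · exact Set.empty_subset B
  · have hdisj : Disjoint (P i) (P j) := hP.2.1 fun h => hij (Fin.ext h)
    dsimp only [Function.onFun]
    split_ifs <;> simp [hdisj]
  · rw [Finset.sum_range]
    refine Finset.sum_congr rfl fun i _ => ?_
    by_cases hi : P i ⊆ B <;> simp [hi, hν0]

theorem exists_measurable_superset_variation_lt {S : Type*} [MeasurableSpace S]
    {ν : Set S → ℝ} {A : Set S} {δ : ℝ} (h : semivariation ν A < δ) :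
    ∃ B, MeasurableSet B ∧ A ⊆ B ∧ variation ν B < δ := by
  have hne : {x | ∃ B : Set S, MeasurableSet B ∧ A ⊆ B ∧ x = variation ν B}.Nonempty :=
    ⟨_, Set.univ, MeasurableSet.univ, Set.subset_univ A, rfl⟩
  obtain ⟨x, ⟨B, hB, hAB, rfl⟩, hlt⟩ := exists_lt_of_csInf_lt hne h
  exact ⟨B, hB, hAB, hlt⟩

/-- if `sup_s ‖g s - h s‖ < ∞`, `g` is `|RL|` `ν`-integrable and `g = h`
`ν`-a.e. (i.e. `ν̃({s : g s ≠ h s}) = 0`), then `h` is `|RL|` `ν`-integrable with the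
same integral. -/
theorem absRL_congr_ae
    {S : Type*} [Nonempty S] [MeasurableSpace S]
    {X : Type*} [NormedAddCommGroup X] [NormedSpace ℝ X] [CompleteSpace X]
    (ν : Set S → ℝ) (hν0 : ν ∅ = 0) (hνnn : ∀ A : Set S, MeasurableSet A → 0 ≤ ν A)
    (hfv : FiniteVariation ν)
    (g h : S → X) (hb : ∃ M : ℝ, ∀ s : S, ‖g s - h s‖ ≤ M)
    (a : X) (hg : AbsRL ν g Set.univ a)
    (hae : semivariation ν {s : S | g s ≠ h s} = 0) :
    AbsRL ν h Set.univ a := by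
  classical
  obtain ⟨M₀, hM₀⟩ := hb
  set M := max M₀ 0 + 1
  have hMpos : 0 < M := by positivity
  have hM : ∀ s, ‖h s - g s‖ ≤ M := fun s => by
    rw [norm_sub_rev]
    linarith [hM₀ s, le_max_left M₀ 0]
  intro ε hε
  obtain ⟨B, hB, hsub, hvar⟩ := exists_measurable_superset_variation_lt
    (hae.trans_lt (by positivity : 0 < ε / 2 / M))
  obtain ⟨P₀, hP₀, hgP₀⟩ := hg (ε / 2) (half_pos hε)
  refine ⟨splitBy P₀ B, hP₀.splitBy hB, fun P hP hfiner => ?_⟩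
  obtain ⟨hbdd, hsum⟩ := hgP₀ P hP ((finerThan_splitBy P₀ B).trans hfiner)
  refine ⟨fun n hn => ?_, fun t ht => ?_⟩
  · obtain ⟨K, hK⟩ := hbdd n hn
    refine ⟨M + K, fun s hs => ?_⟩
    calc ‖h s‖ = ‖(h s - g s) + g s‖ := by rw [sub_add_cancel]
      _ ≤ M + K := norm_add_le_of_le (hM s) (hK s hs)
  · obtain ⟨hgsum, hglt⟩ := hsum t ht
    set v : ℕ → ℝ := fun n => if P n ⊆ B then ν (P n) else 0
    have hv0 : ∀ n, 0 ≤ v n := fun n => by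
      dsimp only [v]
      split_ifs
      · exact hνnn _ (hP.1 n)
      · exact le_rfl
    have hvle := sum_range_le_variation hν0 hfv hP B
    have hvsum : Summable v := summable_of_sum_range_le hv0 hvle
    have hvtsum : ∑' n, v n ≤ variation ν B := Real.tsum_le_of_sum_range_le hv0 hvle
    have hdiff : ∀ n, ‖ν (P n) • (h (t n) - g (t n))‖ ≤ M * v n := fun n => by
      rw [norm_smul, Real.norm_of_nonneg (hνnn _ (hP.1 n))]
      by_cases hn : P n ⊆ B
      · simp only [v, if_pos hn]
        rw [mul_comm M]
        exact mul_le_mul_of_nonneg_left (hM _) (hνnn _ (hP.1 n))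
      · have hdisj := (hfiner.subset_or_disjoint_of_splitBy n).resolve_left hn
        have hmem : t n ∈ P n := ht n (Set.nonempty_of_not_subset hn |>.mono Set.sdiff_subset)
        have heq : g (t n) = h (t n) := by
          by_contra hne
          exact Set.disjoint_left.mp hdisj hmem (hsub hne)
        simp [v, hn, heq]
    have hdsum : Summable fun n => ‖ν (P n) • (h (t n) - g (t n))‖ :=
      (hvsum.mul_left M).of_nonneg_of_le (fun _ => norm_nonneg _) hdiff
    have hdlt : ‖∑' n, ν (P n) • (h (t n) - g (t n))‖ < ε / 2 :=
      calc ‖∑' n, ν (P n) • (h (t n) - g (t n))‖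
          ≤ ∑' n, M * v n := tsum_of_norm_bounded (hvsum.mul_left M).hasSum hdiff
        _ = M * ∑' n, v n := tsum_mul_left
        _ ≤ M * variation ν B := by gcongr
        _ < ε / 2 := by rwa [mul_comm, ← lt_div_iff₀ hMpos]
    have hsplit : ∀ n, ν (P n) • h (t n) =
        ν (P n) • (h (t n) - g (t n)) + ν (P n) • g (t n) := fun n => by
      rw [← smul_add, sub_add_cancel]
    refine ⟨(hdsum.add hgsum).of_nonneg_of_le (fun _ => norm_nonneg _) fun n => ?_, ?_⟩
    · rw [hsplit]
      exact norm_add_le _ _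
    · rw [tsum_congr hsplit, hdsum.of_norm.tsum_add hgsum.of_norm, add_sub_assoc,
        ← add_halves ε]
      exact (norm_add_le _ _).trans_lt (add_lt_add hdlt hglt)
end

section
/- Let ν be of finite variation and h : S → X bounded (hence |RL| ν-integrable on every E ∈ 𝒞), and define T_h : 𝒞 → X by T_h(E) = (|RL|)∫_E h dν. Then T_h is of finite variation, with variation T̄_h(S) ≤ sup_{s∈S}‖h(s)‖ · ν̄(S), and T̄_h is absolutely continuous with respect to ν̄ in the ε–δ sense: for every ε > 0 there exists δ > 0 such that for every A ∈ 𝒞, ν̄(A) < δ implies T̄_h(A) < ε. -/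
open Filter Topology

theorem exists_areTags {S : Type*} [Nonempty S] (P : ℕ → Set S) : ∃ t : ℕ → S, AreTags P t := by
  classical
  refine ⟨fun n => if hn : (P n).Nonempty then hn.some else Classical.arbitrary S, fun n hn => ?_⟩
  simpa only [dif_pos hn] using hn.some_mem

section Variation

variable {S : Type*} [MeasurableSpace S] {ν : Set S → ℝ}

theorem sum_mem_variationSet {ι : Type*} [Fintype ι] {E : Set S} {A : ι → Set S}
    (hA : ∀ i, MeasurableSet (A i)) (hAE : ∀ i, A i ⊆ E)
    (hd : Pairwise (Function.onFun Disjoint A)) : ∑ i, ν (A i) ∈ variationSet ν E := by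
  let e := (Fintype.equivFin ι).symm
  exact ⟨Fintype.card ι, fun i => A (e i), fun i => hA _, fun i => hAE _,
    fun i j hij => hd (e.injective.ne hij), (e.sum_comp fun i => ν (A i)).symm⟩

theorem zero_mem_variationSet (E : Set S) : 0 ∈ variationSet ν E := by
  simpa using sum_mem_variationSet (ν := ν) (E := E) (ι := Fin 0) (A := fun _ => ∅)
    (fun i => i.elim0) (fun i => i.elim0) (fun i => i.elim0)

theorem variationSet_mono {E F : Set S} (hEF : E ⊆ F) : variationSet ν E ⊆ variationSet ν F := by
  rintro x ⟨k, A, hA, hAE, hd, rfl⟩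
  exact ⟨k, A, hA, fun i => (hAE i).trans hEF, hd, rfl⟩

theorem FiniteVariation.bddAbove (hν : FiniteVariation ν) (E : Set S) :
    BddAbove (variationSet ν E) :=
  BddAbove.mono (variationSet_mono (Set.subset_univ E)) hν

theorem FiniteVariation.sum_le_variation (hν : FiniteVariation ν) {ι : Type*} [Fintype ι]
    {E : Set S} {A : ι → Set S} (hA : ∀ i, MeasurableSet (A i)) (hAE : ∀ i, A i ⊆ E)
    (hd : Pairwise (Function.onFun Disjoint A)) : ∑ i, ν (A i) ≤ variation ν E :=
  le_csSup (hν.bddAbove E) (sum_mem_variationSet hA hAE hd)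

theorem FiniteVariation.variation_nonneg (hν : FiniteVariation ν) (E : Set S) :
    0 ≤ variation ν E :=
  le_csSup (hν.bddAbove E) (zero_mem_variationSet E)

/-- The variation is superadditive on finite disjoint families. -/
theorem FiniteVariation.sum_variation_le (hν : FiniteVariation ν) {ι : Type*} [Fintype ι]
    {E : Set S} {A : ι → Set S} (hAE : ∀ i, A i ⊆ E)
    (hd : Pairwise (Function.onFun Disjoint A)) :
    ∑ i, variation ν (A i) ≤ variation ν E := by
  refine le_of_forall_pos_le_add fun ε hε => ?_
  set c : ℝ := (Fintype.card ι : ℝ)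
  have hc : 0 ≤ c := Nat.cast_nonneg _
  have key : ∀ i, ∃ (k : ℕ) (B : Fin k → Set S), (∀ j, MeasurableSet (B j)) ∧
      (∀ j, B j ⊆ A i) ∧ Pairwise (Function.onFun Disjoint B) ∧
      variation ν (A i) - ε / (c + 1) < ∑ j, ν (B j) := by
    intro i
    obtain ⟨_, ⟨k, B, h₁, h₂, h₃, rfl⟩, hx⟩ := exists_lt_of_lt_csSup
      ⟨0, zero_mem_variationSet (ν := ν) (A i)⟩
      (sub_lt_self (variation ν (A i)) (show 0 < ε / (c + 1) by positivity))
    exact ⟨k, B, h₁, h₂, h₃, hx⟩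
  choose k B hB hBA hBd hlt using key
  have hsum : ∑ i, ∑ j, ν (B i j) ≤ variation ν E := by
    rw [← Fintype.sum_sigma' (fun i j => ν (B i j))]
    refine hν.sum_le_variation (ι := Σ i, Fin (k i)) (A := fun p => B p.1 p.2)
      (fun p => hB _ _) (fun p => (hBA _ _).trans (hAE _)) ?_
    rintro ⟨i, j⟩ ⟨i', j'⟩ hne
    by_cases hi : i = i'
    · subst hi
      exact hBd i fun hj => hne (congrArg (Sigma.mk i) hj)
    · exact (hd hi).mono (hBA i j) (hBA i' j')
  have hle : ∑ i, variation ν (A i) ≤ ∑ i, (∑ j, ν (B i j) + ε / (c + 1)) :=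
    Finset.sum_le_sum fun i _ => by linarith [hlt i]
  have hcε : c * (ε / (c + 1)) ≤ ε := by
    rw [mul_div_assoc', div_le_iff₀ (by positivity)]
    nlinarith
  rw [Finset.sum_add_distrib, Finset.sum_const, Finset.card_univ, nsmul_eq_mul] at hle
  linarith

theorem mul_variation_mem_upperBounds (hν : FiniteVariation ν) {μ : Set S → ℝ} {C : ℝ} (hC : 0 ≤ C)
    (hμ : ∀ A, MeasurableSet A → μ A ≤ C * variation ν A) (E : Set S) :
    C * variation ν E ∈ upperBounds (variationSet μ E) := by
  rintro _ ⟨k, A, hA, hAE, hd, rfl⟩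
  calc ∑ i, μ (A i) ≤ ∑ i, C * variation ν (A i) := Finset.sum_le_sum fun i _ => hμ _ (hA i)
    _ = C * ∑ i, variation ν (A i) := (Finset.mul_sum ..).symm
    _ ≤ C * variation ν E := mul_le_mul_of_nonneg_left (hν.sum_variation_le hAE hd) hC

theorem AbsRL.norm_le_mul_variation [Nonempty S] {X : Type*} [NormedAddCommGroup X]
    [NormedSpace ℝ X] (hν : FiniteVariation ν)
    (hνnn : ∀ A, MeasurableSet A → 0 ≤ ν A) {h : S → X} {C : ℝ} (hC : 0 ≤ C)
    (hh : ∀ s, ‖h s‖ ≤ C) {E : Set S} {a : X} (ha : AbsRL ν h E a) :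
    ‖a‖ ≤ C * variation ν E := by
  refine le_of_forall_pos_le_add fun ε hε => ?_
  obtain ⟨P, hP, H⟩ := ha ε hε
  obtain ⟨t, ht⟩ := exists_areTags P
  obtain ⟨hs, hlt⟩ := (H P hP fun n => ⟨n, subset_rfl⟩).2 t ht
  have hPE : ∀ n, P n ⊆ E := fun n => hP.2.2 ▸ Set.subset_iUnion P n
  have hbound : ‖∑' n, ν (P n) • h (t n)‖ ≤ C * variation ν E := by
    refine (norm_tsum_le_tsum_norm hs).trans (hs.tsum_le_of_sum_le fun F => ?_)
    calc ∑ n ∈ F, ‖ν (P n) • h (t n)‖ ≤ ∑ n ∈ F, C * ν (P n) := by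
          refine Finset.sum_le_sum fun n _ => ?_
          rw [norm_smul, Real.norm_of_nonneg (hνnn _ (hP.1 n)), mul_comm]
          exact mul_le_mul_of_nonneg_right (hh _) (hνnn _ (hP.1 n))
      _ = C * ∑ n : F, ν (P n) := by
          rw [← Finset.mul_sum, Finset.sum_coe_sort F fun n => ν (P n)]
      _ ≤ C * variation ν E := by
          refine mul_le_mul_of_nonneg_left ?_ hC
          exact hν.sum_le_variation (A := fun n : F => P n) (fun n => hP.1 n) (fun n => hPE n)
            fun i j hij => hP.2.1 (Subtype.coe_injective.ne hij)
  have := norm_le_norm_add_norm_sub (∑' n, ν (P n) • h (t n)) a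
  linarith

end Variation

/-- the indefinite integral `T_h (E) = (|RL|)∫_E h dν` of a bounded function
with respect to a set function of finite variation is of finite variation, with
`T̄_h(S) ≤ sup_s ‖h s‖ · ν̄(S)`, and `T̄_h ≪ ν̄` in the `ε-δ` sense. -/
theorem absRL_integralOperator_variation
    {S : Type*} [Nonempty S] [MeasurableSpace S]
    {X : Type*} [NormedAddCommGroup X] [NormedSpace ℝ X] [CompleteSpace X]
    (ν : Set S → ℝ) (hν0 : ν ∅ = 0) (hνnn : ∀ A : Set S, MeasurableSet A → 0 ≤ ν A)
    (hfv : FiniteVariation ν)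
    (h : S → X) (hb : ∃ M : ℝ, ∀ s : S, ‖h s‖ ≤ M)
    (T : Set S → X) (hT : ∀ E : Set S, MeasurableSet E → AbsRL ν h E (T E)) :
    FiniteVariation (fun A => ‖T A‖) ∧
    variation (fun A => ‖T A‖) Set.univ ≤ (⨆ s : S, ‖h s‖) * variation ν Set.univ ∧
    ∀ ε > (0 : ℝ), ∃ δ > (0 : ℝ), ∀ A : Set S, MeasurableSet A →
      variation ν A < δ → variation (fun B => ‖T B‖) A < ε := by
  set C := ⨆ s : S, ‖h s‖
  have hh : ∀ s, ‖h s‖ ≤ C := by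
    obtain ⟨M, hM⟩ := hb
    exact le_ciSup ⟨M, Set.forall_mem_range.2 hM⟩
  have hC : 0 ≤ C := (norm_nonneg _).trans (hh (Classical.arbitrary S))
  have hub : ∀ E, C * variation ν E ∈ upperBounds (variationSet (fun A => ‖T A‖) E) :=
    mul_variation_mem_upperBounds hfv hC fun A hA =>
      (hT A hA).norm_le_mul_variation hfv hνnn hC hh
  have hle : ∀ E, variation (fun A => ‖T A‖) E ≤ C * variation ν E := fun E =>
    csSup_le ⟨0, zero_mem_variationSet E⟩ (hub E)
  refine ⟨⟨_, hub Set.univ⟩, hle Set.univ, fun ε hε => ⟨ε / (C + 1), by positivity, ?_⟩⟩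
  intro A _ hA
  rw [lt_div_iff₀ (by positivity)] at hA
  linarith [hle A, hfv.variation_nonneg A]
end
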